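/- The second moments of the coordinates under P are ∫ x₁² dP(x₁,x₂) = 7/22 and ∫ x₂² dP(x₁,x₂) = 3/11. -/

import Mathlib

open MeasureTheory Real Set
open scoped ENNReal NNReal

/-- The three contractive similarities generating the nonhomogeneous R-triangle.
Letters 1,2,3 of the paper correspond to `0,1,2 : Fin 3`. -/
noncomputable def Smap : Fin 3 → ℝ × ℝ → ℝ × ℝ :=
  ![fun x => (x.1 / 4, x.2 / 4),
    fun x => (x.1 / 4 + 3 / 4, x.2 / 4),
    fun x => (x.1 / 2 + 1 / 4, x.2 / 2 + Real.sqrt 3 / 4)]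

/-- `Sw ω = S_{ω₁} ∘ ⋯ ∘ S_{ω_k}` for a word `ω = ω₁⋯ω_k`. -/
noncomputable def Sw (ω : List (Fin 3)) : ℝ × ℝ → ℝ × ℝ :=
  (ω.map Smap).foldr (· ∘ ·) id

/-- The probability weights `p₁ = p₂ = 1/5`, `p₃ = 3/5`. -/
noncomputable def pr : Fin 3 → ℝ := ![1/5, 1/5, 3/5]

/-- The similarity ratios `s₁ = s₂ = 1/4`, `s₃ = 1/2`. -/
noncomputable def sr : Fin 3 → ℝ := ![1/4, 1/4, 1/2]

/-- `p_ω = p_{ω₁}⋯p_{ω_k}`. -/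
noncomputable def pw (ω : List (Fin 3)) : ℝ := (ω.map pr).prod

/-- `s_ω = s_{ω₁}⋯s_{ω_k}`. -/
noncomputable def sw (ω : List (Fin 3)) : ℝ := (ω.map sr).prod

/-- `P` is the nonhomogeneous R-measure:
`P = (1/5)·P∘S₁⁻¹ + (1/5)·P∘S₂⁻¹ + (3/5)·P∘S₃⁻¹`. -/
def IsRMeasure (P : Measure (ℝ × ℝ)) : Prop :=
  P = (1/5 : ℝ≥0∞) • P.map (Smap 0) + (1/5 : ℝ≥0∞) • P.map (Smap 1)
        + (3/5 : ℝ≥0∞) • P.map (Smap 2)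

/-- The closed equilateral triangle with vertices (0,0), (1,0), (1/2, √3/2). -/
noncomputable def Δtri : Set (ℝ × ℝ) :=
  convexHull ℝ ({(0, 0), (1, 0), (1/2, Real.sqrt 3 / 2)} : Set (ℝ × ℝ))

/-- Squared Euclidean distance on ℝ². -/
def sqDist (x a : ℝ × ℝ) : ℝ := (x.1 - a.1) ^ 2 + (x.2 - a.2) ^ 2

theorem Smap_zero_apply (x : ℝ × ℝ) : Smap 0 x = (x.1 / 4, x.2 / 4) := rfl

theorem Smap_one_apply (x : ℝ × ℝ) : Smap 1 x = (x.1 / 4 + 3 / 4, x.2 / 4) := rfl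

theorem Smap_two_apply (x : ℝ × ℝ) :
    Smap 2 x = (x.1 / 2 + 1 / 4, x.2 / 2 + Real.sqrt 3 / 4) := rfl

theorem continuous_Smap (i : Fin 3) : Continuous (Smap i) := by
  fin_cases i
  · change Continuous fun x : ℝ × ℝ => (x.1 / 4, x.2 / 4)
    fun_prop
  · change Continuous fun x : ℝ × ℝ => (x.1 / 4 + 3 / 4, x.2 / 4)
    fun_prop
  · change Continuous fun x : ℝ × ℝ => (x.1 / 2 + 1 / 4, x.2 / 2 + Real.sqrt 3 / 4)
    fun_prop

theorem norm_Smap_le (i : Fin 3) (x : ℝ × ℝ) : ‖Smap i x‖ ≤ ‖x‖ / 2 + 3 / 4 := by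
  have h1 := abs_le.1 (norm_fst_le x)
  have h2 := abs_le.1 (norm_snd_le x)
  have h0 := norm_nonneg x
  have h3 : Real.sqrt 3 ≤ 3 := by
    rw [Real.sqrt_le_left (by norm_num)]
    norm_num
  have h4 := Real.sqrt_nonneg 3
  have key : ∀ a b : ℝ, |a| ≤ ‖x‖ / 2 + 3 / 4 → |b| ≤ ‖x‖ / 2 + 3 / 4 →
      ‖((a, b) : ℝ × ℝ)‖ ≤ ‖x‖ / 2 + 3 / 4 := fun a b ha hb => norm_prod_le_iff.2 ⟨ha, hb⟩
  fin_cases i <;>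
    exact key _ _ (abs_le.2 ⟨by linarith, by linarith⟩) (abs_le.2 ⟨by linarith, by linarith⟩)

theorem IsRMeasure.measure_eq {P : Measure (ℝ × ℝ)} (hP : IsRMeasure P) {s : Set (ℝ × ℝ)}
    (hs : MeasurableSet s) :
    P s = 1 / 5 * P (Smap 0 ⁻¹' s) + 1 / 5 * P (Smap 1 ⁻¹' s) + 3 / 5 * P (Smap 2 ⁻¹' s) := by
  conv_lhs => rw [hP]
  simp only [Measure.add_apply, Measure.smul_apply, smul_eq_mul,
    Measure.map_apply (continuous_Smap _).measurable hs]

theorem ENNReal.weights_sum : (1 / 5 + 1 / 5 + 3 / 5 : ℝ≥0∞) = 1 := by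
  rw [ENNReal.div_add_div_same, ENNReal.div_add_div_same]
  norm_num
  exact ENNReal.div_self (by norm_num) (by norm_num)

theorem IsRMeasure.tail_le {P : Measure (ℝ × ℝ)} (hP : IsRMeasure P) (t : ℝ) :
    P {x | 3 / 2 + t < ‖x‖} ≤ P {x | 3 / 2 + 2 * t < ‖x‖} := by
  have hsub : ∀ i, Smap i ⁻¹' {x | 3 / 2 + t < ‖x‖} ⊆ {x | 3 / 2 + 2 * t < ‖x‖} := by
    intro i x hx
    have hx' : 3 / 2 + t < ‖Smap i x‖ := hx
    have := norm_Smap_le i x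
    change 3 / 2 + 2 * t < ‖x‖
    linarith
  rw [hP.measure_eq (measurableSet_lt measurable_const measurable_norm)]
  calc _ ≤ 1 / 5 * P {x | 3 / 2 + 2 * t < ‖x‖} + 1 / 5 * P {x | 3 / 2 + 2 * t < ‖x‖}
        + 3 / 5 * P {x | 3 / 2 + 2 * t < ‖x‖} := by
        gcongr <;> exact hsub _
    _ = P {x | 3 / 2 + 2 * t < ‖x‖} := by
        rw [← add_mul, ← add_mul, ENNReal.weights_sum, one_mul]

theorem IsRMeasure.tail_eq_zero {P : Measure (ℝ × ℝ)} [IsFiniteMeasure P] (hP : IsRMeasure P)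
    {t : ℝ} (ht : 0 < t) : P {x | 3 / 2 + t < ‖x‖} = 0 := by
  have hle : ∀ n : ℕ, P {x | 3 / 2 + t < ‖x‖} ≤ P {x | 3 / 2 + 2 ^ n * t < ‖x‖} := by
    intro n
    induction n with
    | zero => simp
    | succ n ih =>
      refine ih.trans ((hP.tail_le _).trans_eq ?_)
      rw [pow_succ', mul_assoc]
  have hanti : Antitone fun n : ℕ => {x : ℝ × ℝ | 3 / 2 + 2 ^ n * t < ‖x‖} := by
    intro m n hmn x hx
    refine lt_of_le_of_lt ?_ (show 3 / 2 + 2 ^ n * t < ‖x‖ from hx)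
    gcongr
    norm_num
  have hinter : ⋂ n : ℕ, {x : ℝ × ℝ | 3 / 2 + 2 ^ n * t < ‖x‖} = ∅ := by
    refine eq_empty_of_forall_notMem fun x hx => ?_
    obtain ⟨n, hn⟩ := pow_unbounded_of_one_lt (‖x‖ / t) (one_lt_two : (1 : ℝ) < 2)
    have h1 : 3 / 2 + 2 ^ n * t < ‖x‖ := mem_iInter.1 hx n
    rw [div_lt_iff₀ ht] at hn
    linarith
  have hlim := tendsto_measure_iInter_atTop (μ := P)
    (fun n => (measurableSet_lt measurable_const measurable_norm).nullMeasurableSet)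
    hanti ⟨0, measure_ne_top _ _⟩
  rw [hinter, measure_empty] at hlim
  exact le_antisymm (ge_of_tendsto' hlim hle) zero_le

theorem IsRMeasure.integrable_of_continuous {P : Measure (ℝ × ℝ)} [IsFiniteMeasure P]
    (hP : IsRMeasure P) {f : ℝ × ℝ → ℝ} (hf : Continuous f) : Integrable f P := by
  obtain ⟨C, hC⟩ := (isCompact_closedBall (0 : ℝ × ℝ) (3 / 2 + 1)).exists_bound_of_continuousOn
    hf.continuousOn
  refine Integrable.of_bound hf.aestronglyMeasurable C ?_
  have h : ∀ᵐ x ∂P, ¬ 3 / 2 + 1 < ‖x‖ := by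
    rw [ae_iff]
    simpa only [not_not] using hP.tail_eq_zero one_pos
  filter_upwards [h] with x hx
  exact hC x (mem_closedBall_zero_iff.2 (not_lt.1 hx))

theorem IsRMeasure.integral_eq {P : Measure (ℝ × ℝ)} [IsFiniteMeasure P] (hP : IsRMeasure P)
    {f : ℝ × ℝ → ℝ} (hf : Continuous f) :
    ∫ x, f x ∂P = 1 / 5 * ∫ x, f (Smap 0 x) ∂P + 1 / 5 * ∫ x, f (Smap 1 x) ∂P
      + 3 / 5 * ∫ x, f (Smap 2 x) ∂P := by
  have hi : ∀ i (c : ℝ≥0∞), c ≠ ⊤ → Integrable f (c • P.map (Smap i)) := fun i c hc =>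
    ((integrable_map_measure hf.aestronglyMeasurable (continuous_Smap i).aemeasurable).2
      (hP.integrable_of_continuous (hf.comp (continuous_Smap i)))).smul_measure hc
  have h1 : (1 / 5 : ℝ≥0∞) ≠ ⊤ := ENNReal.div_ne_top (by norm_num) (by norm_num)
  have h3 : (3 / 5 : ℝ≥0∞) ≠ ⊤ := ENNReal.div_ne_top (by norm_num) (by norm_num)
  have hm : ∀ i, ∫ x, f x ∂(P.map (Smap i)) = ∫ x, f (Smap i x) ∂P := fun i =>
    integral_map (continuous_Smap i).aemeasurable hf.aestronglyMeasurable
  conv_lhs => rw [hP]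
  rw [integral_add_measure ((hi 0 _ h1).add_measure (hi 1 _ h1)) (hi 2 _ h3),
    integral_add_measure (hi 0 _ h1) (hi 1 _ h1)]
  simp only [integral_smul_measure, hm, smul_eq_mul, ENNReal.toReal_div, ENNReal.toReal_one,
    ENNReal.toReal_ofNat]

theorem integral_quadratic {α : Type*} [MeasurableSpace α] {P : Measure α}
    [IsProbabilityMeasure P] {g : α → ℝ} (h1 : Integrable g P)
    (h2 : Integrable (fun x => g x ^ 2) P) (a b c : ℝ) :
    ∫ x, (a * g x ^ 2 + b * g x + c) ∂P = a * ∫ x, g x ^ 2 ∂P + b * ∫ x, g x ∂P + c := by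
  rw [integral_add (f := fun x => a * g x ^ 2 + b * g x)
      ((h2.const_mul a).add (h1.const_mul b)) (integrable_const c),
    integral_add (h2.const_mul a) (h1.const_mul b), integral_const_mul, integral_const_mul]
  simp

/-- The first two moments of a coordinate `g` transformed affinely by each of the `Smap i` satisfy
the linear relations coming from self-similarity. -/
theorem IsRMeasure.moment_relations {P : Measure (ℝ × ℝ)} [IsProbabilityMeasure P]
    (hP : IsRMeasure P) {g : ℝ × ℝ → ℝ} (hg : Continuous g) {b₁ b₂ : ℝ}
    (h0 : ∀ x, g (Smap 0 x) = g x / 4) (h1 : ∀ x, g (Smap 1 x) = g x / 4 + b₁)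
    (h2 : ∀ x, g (Smap 2 x) = g x / 2 + b₂) :
    ∫ x, g x ∂P = 2 / 5 * (∫ x, g x ∂P) + 1 / 5 * b₁ + 3 / 5 * b₂ ∧
    ∫ x, g x ^ 2 ∂P = 7 / 40 * (∫ x, g x ^ 2 ∂P)
      + (1 / 10 * b₁ + 3 / 5 * b₂) * (∫ x, g x ∂P) + 1 / 5 * b₁ ^ 2 + 3 / 5 * b₂ ^ 2 := by
  have q := integral_quadratic (hP.integrable_of_continuous hg)
    (hP.integrable_of_continuous (hg.pow 2))
  constructor
  · have e0 : ∀ x, g (Smap 0 x) = 0 * g x ^ 2 + 1 / 4 * g x + 0 := fun x => by rw [h0]; ring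
    have e1 : ∀ x, g (Smap 1 x) = 0 * g x ^ 2 + 1 / 4 * g x + b₁ := fun x => by rw [h1]; ring
    have e2 : ∀ x, g (Smap 2 x) = 0 * g x ^ 2 + 1 / 2 * g x + b₂ := fun x => by rw [h2]; ring
    have h := hP.integral_eq hg
    simp only [e0, e1, e2, q] at h
    linarith
  · have e0 : ∀ x, g (Smap 0 x) ^ 2 = 1 / 16 * g x ^ 2 + 0 * g x + 0 :=
      fun x => by rw [h0]; ring
    have e1 : ∀ x, g (Smap 1 x) ^ 2 = 1 / 16 * g x ^ 2 + b₁ / 2 * g x + b₁ ^ 2 :=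
      fun x => by rw [h1]; ring
    have e2 : ∀ x, g (Smap 2 x) ^ 2 = 1 / 4 * g x ^ 2 + b₂ * g x + b₂ ^ 2 :=
      fun x => by rw [h2]; ring
    have h := hP.integral_eq (f := fun x => g x ^ 2) (hg.pow 2)
    simp only [e0, e1, e2, q] at h
    linarith

/-- `E(X₁²) = 7/22` and `E(X₂²) = 3/11`. -/
theorem stmt_4 (P : Measure (ℝ × ℝ)) [IsProbabilityMeasure P] (hP : IsRMeasure P) :
    (∫ x : ℝ × ℝ, x.1 ^ 2 ∂P) = 7/22 ∧ (∫ x : ℝ × ℝ, x.2 ^ 2 ∂P) = 3/11 := by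
  constructor
  · obtain ⟨h1, h2⟩ := hP.moment_relations continuous_fst (b₁ := 3 / 4) (b₂ := 1 / 4)
      (fun x => by rw [Smap_zero_apply]) (fun x => by rw [Smap_one_apply])
      (fun x => by rw [Smap_two_apply])
    have hm : ∫ x : ℝ × ℝ, x.1 ∂P = 1 / 2 := by linarith
    rw [hm] at h2
    linarith
  · obtain ⟨h1, h2⟩ := hP.moment_relations continuous_snd (b₁ := 0) (b₂ := Real.sqrt 3 / 4)
      (fun x => by rw [Smap_zero_apply]) (fun x => by rw [Smap_one_apply, add_zero])
      (fun x => by rw [Smap_two_apply])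
    have hm : ∫ x : ℝ × ℝ, x.2 ∂P = Real.sqrt 3 / 4 := by linarith
    rw [hm] at h2
    have hs : Real.sqrt 3 ^ 2 = 3 := Real.sq_sqrt (by norm_num)
    nlinarith
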